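/- Let (Ω, F, P) be a probability space, T ≥ 1, and let G_1, …, G_T be events. For 0 ≤ t ≤ T set O_t = ∑_{n=1}^t 1_{G_n} (a random variable). Suppose α > 1/2, c ≥ 0 and K ≥ 0 are real numbers such that for every n ∈ {1,…,T}, P( G_n ∩ {O_{n−1} > c} ) ≤ K·n^{−2α}. Then E[O_T] ≤ c + 1 + K·2α/(2α−1). -/

import Mathlib

open MeasureTheory
open scoped Classical

/-- Telescoping bound for one term of a convergent `p`-series. -/
lemma rpow_neg_le_sub_rpow {p : ℝ} (hp : 1 < p) {x : ℝ} (hx : 0 < x) :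
    (p - 1) * (x + 1) ^ (-p) ≤ x ^ (1 - p) - (x + 1) ^ (1 - p) := by
  have hx1 : 0 < x + 1 := by linarith
  have hr : 0 < x / (x + 1) := div_pos hx hx1
  have hlog : Real.log (x / (x + 1)) ≤ -(1 / (x + 1)) := by
    have h := Real.log_le_sub_one_of_pos hr
    have e : x / (x + 1) - 1 = -(1 / (x + 1)) := by field_simp; ring
    rwa [e] at h
  have hratio : 1 + (p - 1) * (1 / (x + 1)) ≤ (x / (x + 1)) ^ (1 - p) := by
    rw [Real.rpow_def_of_pos hr]
    have h := Real.add_one_le_exp (Real.log (x / (x + 1)) * (1 - p))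
    nlinarith
  have hsplit : x ^ (1 - p) = (x / (x + 1)) ^ (1 - p) * (x + 1) ^ (1 - p) := by
    rw [← Real.mul_rpow hr.le hx1.le, div_mul_cancel₀ _ hx1.ne']
  have hstep : (x + 1) ^ (-p) = 1 / (x + 1) * (x + 1) ^ (1 - p) := by
    rw [show 1 - p = -p + 1 by ring, Real.rpow_add_one hx1.ne']
    field_simp
  have hmul := mul_le_mul_of_nonneg_right hratio (Real.rpow_nonneg hx1.le (1 - p))
  rw [hsplit, hstep]
  linarith

lemma sum_Icc_rpow_neg_le {p : ℝ} (hp : 1 < p) (T : ℕ) :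
    ∑ n ∈ Finset.Icc 1 T, (n : ℝ) ^ (-p) ≤ p / (p - 1) := by
  have hp' : 0 < p - 1 := by linarith
  have key (t : ℕ) : (p - 1) * ∑ n ∈ Finset.Icc 1 (t + 1), (n : ℝ) ^ (-p)
      ≤ p - ((t : ℝ) + 1) ^ (1 - p) := by
    induction t with
    | zero => simp
    | succ t ih =>
      rw [Finset.sum_Icc_succ_top (by omega), mul_add]
      have h := rpow_neg_le_sub_rpow hp (x := (t : ℝ) + 1) (by positivity)
      push_cast at ih ⊢
      linarith
  rw [le_div_iff₀' hp']
  cases T with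
  | zero => simp; linarith
  | succ t =>
    have h : 0 ≤ ((t : ℝ) + 1) ^ (1 - p) := by positivity
    linarith [key t]

/-- A count exceeds a level `c` by at most one plus the number of increments occurring above `c`. -/
lemma sum_ite_le_add_sum_ite_lt (g : ℕ → Prop) {c : ℝ} (hc : 0 ≤ c) (S : ℕ → ℝ)
    (hS : ∀ t, S t = ∑ n ∈ Finset.Icc 1 t, (if g n then (1 : ℝ) else 0)) (t : ℕ) :
    S t ≤ c + 1 + ∑ n ∈ Finset.Icc 1 t, (if g n ∧ c < S (n - 1) then (1 : ℝ) else 0) := by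
  induction t with
  | zero => simp [hS]; linarith
  | succ t ih =>
    have hsucc : S (t + 1) = S t + if g (t + 1) then (1 : ℝ) else 0 := by
      rw [hS, hS, Finset.sum_Icc_succ_top (by omega)]
    have hnonneg : 0 ≤ ∑ n ∈ Finset.Icc 1 t,
        (if g n ∧ c < S (n - 1) then (1 : ℝ) else 0) :=
      Finset.sum_nonneg fun n _ => by split_ifs <;> norm_num
    rw [Finset.sum_Icc_succ_top (by omega), hsucc, Nat.add_sub_cancel]
    by_cases hg : g (t + 1) <;> by_cases hlt : c < S t <;> simp only [hg, hlt, and_self,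
      and_true, and_false, if_true, if_false] <;> linarith

/-- Abstract offload-counting bound: if `O_t` counts the occurrences of events
`G_1,…,G_T` and each `G_n` can occur together with `{O_{n−1} > c}` only with
probability at most `K n^{−2α}` (for `α > 1/2`), then `E[O_T] ≤ c + 1 + K·2α/(2α−1)`. -/
theorem stmt_5 {Ω : Type*} [MeasurableSpace Ω] (P : Measure Ω) [IsProbabilityMeasure P]
    (T : ℕ) (hT : 1 ≤ T) (G : ℕ → Set Ω)
    (hGmeas : ∀ n ∈ Finset.Icc 1 T, MeasurableSet (G n))
    (O : ℕ → Ω → ℝ)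
    (hO : ∀ t, ∀ ω, O t ω = ∑ n ∈ Finset.Icc 1 t, (if ω ∈ G n then (1 : ℝ) else 0))
    (α c K : ℝ) (hα : 1 / 2 < α) (hc : 0 ≤ c) (hK : 0 ≤ K)
    (hyp : ∀ n ∈ Finset.Icc 1 T,
      (P (G n ∩ {ω | c < O (n - 1) ω})).toReal ≤ K * (n : ℝ) ^ (-(2 * α))) :
    ∫ ω, O T ω ∂P ≤ c + 1 + K * (2 * α / (2 * α - 1)) := by
  have hOmeas : ∀ t ≤ T, Measurable (O t) := fun t ht => by
    rw [funext (hO t)]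
    refine Finset.measurable_fun_sum _ fun n hn => ?_
    have hn' := Finset.mem_Icc.mp hn
    exact Measurable.ite (hGmeas n (Finset.mem_Icc.mpr ⟨hn'.1, hn'.2.trans ht⟩))
      measurable_const measurable_const
  set B : ℕ → Set Ω := fun n => G n ∩ {ω | c < O (n - 1) ω} with hB
  have hBmeas : ∀ n ∈ Finset.Icc 1 T, MeasurableSet (B n) := fun n hn =>
    (hGmeas n hn).inter (measurableSet_lt measurable_const
      (hOmeas _ ((Nat.sub_le n 1).trans (Finset.mem_Icc.mp hn).2)))
  have hBint : ∀ n ∈ Finset.Icc 1 T, Integrable ((B n).indicator (1 : Ω → ℝ)) P :=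
    fun n hn => (integrable_const (1 : ℝ)).indicator (hBmeas n hn)
  have hOint : Integrable (O T) P := by
    rw [funext (hO T)]
    exact integrable_finsetSum _ fun n hn =>
      ((integrable_const (1 : ℝ)).indicator (hGmeas n hn)).congr
        (.of_forall fun ω => by simp [Set.indicator_apply])
  have hpt (ω : Ω) : O T ω ≤ c + 1 + ∑ n ∈ Finset.Icc 1 T, (B n).indicator (1 : Ω → ℝ) ω := by
    simpa [hB, Set.indicator_apply] using
      sum_ite_le_add_sum_ite_lt (fun n => ω ∈ G n) hc (fun t => O t ω) (fun t => hO t ω) T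
  have hsumint := integrable_finsetSum _ hBint
  calc ∫ ω, O T ω ∂P
      ≤ ∫ ω, (c + 1 + ∑ n ∈ Finset.Icc 1 T, (B n).indicator (1 : Ω → ℝ) ω) ∂P :=
        integral_mono hOint ((integrable_const _).add hsumint) hpt
    _ = c + 1 + ∑ n ∈ Finset.Icc 1 T, (P (B n)).toReal := by
        rw [integral_add (integrable_const _) hsumint, integral_finsetSum _ hBint]
        congr 1
        · simp
        · exact Finset.sum_congr rfl fun n hn => integral_indicator_one (hBmeas n hn)
    _ ≤ c + 1 + K * ∑ n ∈ Finset.Icc 1 T, (n : ℝ) ^ (-(2 * α)) := by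
        rw [Finset.mul_sum]
        gcongr with n hn
        exact hyp n hn
    _ ≤ c + 1 + K * (2 * α / (2 * α - 1)) := by
        gcongr
        exact sum_Icc_rpow_neg_le (by linarith) T
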